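/- arXiv:2111.04660 — 8 statements merged into one kernel-verified Lean document; each statement's English description precedes it below -/
import Mathlib

section
/- Let K be a field, f, g ∈ K[x] monic polynomials, and L a field extension of K. If α ∈ L is a root of f and β ∈ L is a root of g, then α + β is a root of R_{f,g}, i.e. the evaluation of R_{f,g} at α + β in L is zero. -/
open Polynomial

/-- The Sylvester matrix of two polynomials `f` and `g`, regarded as having degrees
`n` and `m` respectively: the first `m` rows contain the coefficients of `f`
(in descending order, shifted), the last `n` rows those of `g`. -/
noncomputable def sylvester {R : Type*} [CommRing R] (n m : ℕ) (f g : R[X]) :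
    Matrix (Fin (m + n)) (Fin (m + n)) R :=
  Matrix.of fun i j =>
    if (i : ℕ) < m then
      (if (j : ℕ) ≤ n + (i : ℕ) then f.coeff (n + (i : ℕ) - (j : ℕ)) else 0)
    else
      (if (j : ℕ) ≤ m + ((i : ℕ) - m) then g.coeff (m + ((i : ℕ) - m) - (j : ℕ)) else 0)

/-- The resultant of two polynomials `f` and `g`, regarded as having degrees
`n` and `m` respectively: the determinant of their Sylvester matrix. -/
noncomputable def resultant {R : Type*} [CommRing R] (n m : ℕ) (f g : R[X]) : R :=
  (sylvester n m f g).det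

/-- `Rres f g` is the polynomial `R_{f,g}(y) = Res_x(f(x), g(y - x))`, the resultant with
respect to the variable `x` of `f(x)` and `g(y - x)`, viewed as a polynomial in `y`. -/
noncomputable def Rres {R : Type*} [CommRing R] (f g : R[X]) : R[X] :=
  resultant f.natDegree g.natDegree (f.map (C : R →+* R[X]))
    ((g.map (C : R →+* R[X])).comp (C X - X))


theorem resultant_map {R S : Type*} [CommRing R] [CommRing S] (φ : R →+* S) (n m : ℕ)
    (f g : R[X]) : resultant n m (f.map φ) (g.map φ) = φ (resultant n m f g) := by
  unfold _root_.resultant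
  rw [RingHom.map_det]
  congr 1
  ext i j
  simp only [_root_.sylvester, Matrix.of_apply, coeff_map, RingHom.mapMatrix_apply, Matrix.map_apply]
  split_ifs <;> simp

theorem sum_shifted_coeff_mul_pow {R : Type*} [CommRing R] (p : R[X]) (a : R) {N k : ℕ}
    (hk : k < N) (hp : p.natDegree ≤ k) :
    ∑ j : Fin N, (if (j : ℕ) ≤ k then p.coeff (k - (j : ℕ)) else 0) * a ^ (N - 1 - (j : ℕ)) =
      a ^ (N - 1 - k) * p.eval a := by
  rw [Fin.sum_univ_eq_sum_range
    (fun j => (if j ≤ k then p.coeff (k - j) else 0) * a ^ (N - 1 - j)) N,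
    ← Finset.sum_subset (Finset.range_subset_range.2 (Nat.succ_le_of_lt hk)),
    ← Finset.sum_range_reflect, eval_eq_sum_range' (Nat.lt_succ_of_le hp), Finset.mul_sum]
  · refine Finset.sum_congr rfl fun j hj => ?_
    have hj' : j ≤ k := Nat.lt_succ_iff.1 (Finset.mem_range.1 hj)
    rw [if_pos (by omega), show k - (k.succ - 1 - j) = j by omega,
      show N - 1 - (k.succ - 1 - j) = (N - 1 - k) + j by omega, pow_add]
    ring
  · intro j _ hj
    rw [if_neg (by simpa using hj), zero_mul]

/-- The resultant vanishes as soon as the two polynomials have a common root. -/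
theorem resultant_eq_zero_of_isRoot {R : Type*} [CommRing R] [IsDomain R] {n m : ℕ}
    {f g : R[X]} (hn : 0 < n) (hf : f.natDegree ≤ n) (hg : g.natDegree ≤ m) {a : R}
    (hfa : f.IsRoot a) (hga : g.IsRoot a) : resultant n m f g = 0 := by
  refine Matrix.exists_mulVec_eq_zero_iff.1
    ⟨fun j : Fin (m + n) => a ^ (m + n - 1 - (j : ℕ)), fun h => ?_, ?_⟩
  · simpa using congrFun h ⟨m + n - 1, by omega⟩
  · ext i
    simp only [Matrix.mulVec, dotProduct, _root_.sylvester, Matrix.of_apply, Pi.zero_apply]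
    by_cases hi : (i : ℕ) < m
    · simp only [if_pos hi]
      rw [sum_shifted_coeff_mul_pow f a (by omega) (by omega), hfa.eq_zero, mul_zero]
    · simp only [if_neg hi]
      rw [sum_shifted_coeff_mul_pow g a (by omega) (by omega), hga.eq_zero, mul_zero]

/-- if `f, g ∈ K[x]` are monic, `L/K` is a field extension, `α ∈ L` is a root
of `f` and `β ∈ L` is a root of `g`, then `α + β` is a root of `R_{f,g}`. -/
theorem stmt1 {K L : Type*} [Field K] [Field L] [Algebra K L] (f g : K[X])
    (hf : f.Monic) (hg : g.Monic) (α β : L)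
    (hα : Polynomial.aeval α f = 0) (hβ : Polynomial.aeval β g = 0) :
    Polynomial.aeval (α + β) (Rres f g) = 0 := by
  have hn : 0 < f.natDegree := by
    refine Nat.pos_of_ne_zero fun h => ?_
    rw [hf.natDegree_eq_zero.1 h, map_one] at hα
    exact one_ne_zero hα
  have hφ : ((aeval (α + β) : K[X] →ₐ[K] L) : K[X] →+* L).comp C = algebraMap K L := by
    ext x
    simp
  change ((aeval (α + β) : K[X] →ₐ[K] L) : K[X] →+* L) (Rres f g) = 0
  rw [Rres, ← resultant_map]
  refine resultant_eq_zero_of_isRoot (a := α) hn ?_ ?_ ?_ ?_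
  · exact natDegree_map_le.trans natDegree_map_le
  · refine natDegree_map_le.trans (natDegree_comp_le.trans ?_)
    have h : (C X - X : K[X][X]).natDegree ≤ 1 := by
      compute_degree
    exact (Nat.mul_le_mul natDegree_map_le h).trans (mul_one _).le
  · rw [IsRoot.def, map_map, hφ, eval_map_algebraMap, hα]
  · rw [IsRoot.def, Polynomial.map_comp, map_map, hφ, eval_comp]
    simpa using hβ
end

section
/- Let K be a field and f, g ∈ K[x] monic polynomials of degrees n and m that split completely over an extension field L, say f(x) = ∏_{i=1}^n (x − α_i) and g(x) = ∏_{j=1}^m (x − β_j) in L[x]. Then, as polynomials in L[y], R_{f,g}(y) = ∏_{i=1}^n ∏_{j=1}^m (y − α_i − β_j). -/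
open Polynomial

theorem resultant_eq_polynomial_resultant {R : Type*} [CommRing R] {n m : ℕ} {f g : R[X]}
    (hf : f.natDegree ≤ n) (hg : g.natDegree ≤ m) :
    _root_.resultant n m f g = Polynomial.resultant f g n m := by
  have h : _root_.sylvester n m f g = (Polynomial.sylvester f g n m).transpose.submatrix
      (Fin.revPerm.trans (finCongr (add_comm m n))) (Fin.revPerm.trans (finCongr (add_comm m n))) := by
    ext i j
    obtain ⟨k, rfl⟩ := ((finCongr (add_comm n m)).trans Fin.revPerm).surjective i
    have hj := j.isLt
    induction k using Fin.addCases with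
    | left k =>
      have hk := k.isLt
      have hlt : ¬ m + n - (k + 1) < m := by lia
      simp only [_root_.sylvester, Polynomial.sylvester, Matrix.of_apply, Matrix.submatrix_apply,
        Matrix.transpose_apply, Equiv.trans_apply, Fin.revPerm_apply, finCongr_apply,
        Fin.val_rev, Fin.val_cast, Fin.val_castAdd, Fin.cast_rev, Fin.rev_rev, Fin.cast_cast,
        Fin.cast_refl, Fin.addCases_left, Set.mem_Icc, id, if_neg hlt]
      split_ifs
      · congr 1; lia
      · exact coeff_eq_zero_of_natDegree_lt (by lia)
      · lia
      · rfl
    | right k =>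
      have hk := k.isLt
      have hlt : m + n - (n + k + 1) < m := by lia
      simp only [_root_.sylvester, Polynomial.sylvester, Matrix.of_apply, Matrix.submatrix_apply,
        Matrix.transpose_apply, Equiv.trans_apply, Fin.revPerm_apply, finCongr_apply,
        Fin.val_rev, Fin.val_cast, Fin.val_natAdd, Fin.cast_rev, Fin.rev_rev, Fin.cast_cast,
        Fin.cast_refl, Fin.addCases_right, Set.mem_Icc, id, if_pos hlt]
      split_ifs
      · congr 1; lia
      · exact coeff_eq_zero_of_natDegree_lt (by lia)
      · lia
      · rfl
  rw [_root_.resultant, h, Matrix.det_submatrix_equiv_self, Matrix.det_transpose,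
    Polynomial.resultant]

theorem resultant_prod_X_sub_C_left {R : Type*} [CommRing R] [Nontrivial R] {n m : ℕ}
    (a : Fin n → R) {g : R[X]} (hg : g.natDegree ≤ m) :
    Polynomial.resultant (∏ i, (X - C (a i))) g n m = ∏ i, g.eval (a i) := by
  have h := Polynomial.resultant_prod_left Finset.univ (fun i => X - C (a i)) g m (by simp) hg
  simpa [natDegree_prod_of_monic _ _ fun i _ => monic_X_sub_C (a i), hg] using h

theorem natDegree_comp_C_sub_X_le {R : Type*} [CommRing R] (g : R[X]) (r : R) :
    (g.comp (C r - X)).natDegree ≤ g.natDegree := by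
  have h : (C r - X : R[X]).natDegree ≤ 1 := by compute_degree
  calc (g.comp (C r - X)).natDegree ≤ g.natDegree * (C r - X : R[X]).natDegree :=
        natDegree_comp_le
    _ ≤ g.natDegree := by simpa using Nat.mul_le_mul_left g.natDegree h

/-- if `f, g ∈ K[x]` are monic of degrees `n`, `m` and split completely over an
extension `L` as `f = ∏ᵢ (x - αᵢ)`, `g = ∏ⱼ (x - βⱼ)`, then in `L[y]` one has
`R_{f,g}(y) = ∏ᵢ ∏ⱼ (y - αᵢ - βⱼ)`. -/
theorem stmt2 {K L : Type*} [Field K] [Field L] [Algebra K L] (f g : K[X]) (n m : ℕ)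
    (hf : f.Monic) (hg : g.Monic) (hn : f.natDegree = n) (hm : g.natDegree = m)
    (α : Fin n → L) (β : Fin m → L)
    (hfsplit : f.map (algebraMap K L) = ∏ i : Fin n, (X - C (α i)))
    (hgsplit : g.map (algebraMap K L) = ∏ j : Fin m, (X - C (β j))) :
    (Rres f g).map (algebraMap K L) = ∏ i : Fin n, ∏ j : Fin m, (X - C (α i + β j)) := by
  have hG := (natDegree_comp_C_sub_X_le (g.map (C : K →+* K[X])) X).trans natDegree_map_le
  have hG' := (natDegree_map_le (f := mapRingHom (algebraMap K L))).trans hG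
  have hC : (mapRingHom (algebraMap K L)).comp C = (C : L →+* L[X]).comp (algebraMap K L) := by
    ext; simp
  rw [Rres, resultant_eq_polynomial_resultant natDegree_map_le hG, ← coe_mapRingHom,
    ← Polynomial.resultant_map_map, map_map, hC, ← map_map, hfsplit, hn, hm]
  rw [hm] at hG'
  have hα : (∏ i, (X - C (α i))).map (C : L →+* L[X]) = ∏ i, (X - C (C (α i))) := by
    simp [Polynomial.map_prod]
  rw [hα, resultant_prod_X_sub_C_left _ hG']
  refine Finset.prod_congr rfl fun i _ => ?_
  rw [map_comp, map_map, hC, ← map_map, hgsplit]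
  simp [Polynomial.map_prod, eval_prod, prod_comp, sub_sub]
end

section
/- Let α and β be algebraic numbers in a fixed algebraic closure of ℚ such that the number fields ℚ(α) and ℚ(β) are linearly disjoint over ℚ. Then the compositum ℚ(α)·ℚ(β) equals ℚ(α + β); in particular ℚ(α, β) = ℚ(α + β). -/
open IntermediateField

section

variable {F E : Type*} [Field F] [Field E] [Algebra F E]

/-- If `A` and `F(β)` are linearly disjoint over `F`, then the minimal polynomial of `β` does not
change when the base field is extended from `F` to `A`. -/
theorem IntermediateField.LinearDisjoint.minpoly_eq_map {A : IntermediateField F E} {β : E}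
    (hβ : IsIntegral F β) (H : A.LinearDisjoint (adjoin F ({β} : Set E))) :
    minpoly A β = (minpoly F β).map (algebraMap F A) := by
  have : Algebra.IsAlgebraic F (adjoin F ({β} : Set E)) :=
    isAlgebraic_adjoin_simple hβ
  have hadj : adjoin A ((adjoin F ({β} : Set E) : IntermediateField F E) : Set E)
      = adjoin A ({β} : Set E) := by
    apply le_antisymm
    · rw [adjoin_le_iff]
      have h : adjoin F ({β} : Set E) ≤ (adjoin A ({β} : Set E)).restrictScalars F := by
        rw [adjoin_simple_le_iff]
        exact mem_adjoin_simple_self A β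
      exact h
    · rw [adjoin_simple_le_iff]
      exact subset_adjoin _ _ (mem_adjoin_simple_self F β)
  have hrank : Module.finrank A (adjoin A ({β} : Set E))
      = Module.finrank F (adjoin F ({β} : Set E)) := by
    rw [← hadj]
    exact congrArg Cardinal.toNat H.symm.adjoin_rank_eq_rank_left_of_isAlgebraic_left
  rw [adjoin.finrank hβ.tower_top, adjoin.finrank hβ] at hrank
  refine (Polynomial.eq_of_monic_of_dvd_of_natDegree_le (minpoly.monic hβ.tower_top)
    ((minpoly.monic hβ).map _) (minpoly.dvd_map_of_isScalarTower F A β) ?_).symm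
  rw [Polynomial.natDegree_map, hrank]

/-- If `F(α)` and `F(β)` are linearly disjoint over `F`, then any conjugates of `α` and of `β` are
simultaneously the images of `α` and `β` under an automorphism of the normal extension `E`. -/
theorem IntermediateField.LinearDisjoint.exists_algEquiv_apply_eq [Normal F E] {α β a b : E}
    (H : (adjoin F ({α} : Set E)).LinearDisjoint (adjoin F ({β} : Set E)))
    (ha : IsConjRoot F α a) (hb : IsConjRoot F β b) :
    ∃ τ : E ≃ₐ[F] E, τ α = a ∧ τ β = b := by
  obtain ⟨σ, rfl⟩ := isConjRoot_iff_exists_algEquiv.1 ha.symm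
  have : Normal (adjoin F ({α} : Set E)) E := Normal.tower_top_of_normal F _ E
  have hβ : IsIntegral F β := Normal.isIntegral inferInstance β
  have hroot : Polynomial.aeval (σ.symm b) (minpoly F β) = 0 := by
    rw [Polynomial.aeval_algHom_apply σ.symm, hb.aeval_eq_zero, map_zero]
  have hconj : IsConjRoot (adjoin F ({α} : Set E)) β (σ.symm b) := by
    refine isConjRoot_of_aeval_eq_zero hβ.tower_top ?_
    rw [H.minpoly_eq_map hβ, Polynomial.aeval_map_algebraMap, hroot]
  obtain ⟨ρ, hρ⟩ := isConjRoot_iff_exists_algEquiv.1 hconj.symm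
  refine ⟨(ρ.restrictScalars F).trans σ, ?_, ?_⟩
  · have : ρ α = α := ρ.commutes (AdjoinSimple.gen F α)
    simp [this]
  · simp [hρ]

/-- If `F(α)` and `F(β)` are linearly disjoint over `F`, then any automorphism of the normal
extension `E` fixing `α + β` fixes `α`. -/
theorem IntermediateField.LinearDisjoint.apply_eq_of_apply_add_eq [CharZero F] [Normal F E]
    {α β : E} (H : (adjoin F ({α} : Set E)).LinearDisjoint (adjoin F ({β} : Set E)))
    (σ : E ≃ₐ[F] E) (hσ : σ (α + β) = α + β) : σ α = α := by
  classical
  have : CharZero E := charZero_of_injective_algebraMap (algebraMap F E).injective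
  let _ : Algebra ℚ E := DivisionRing.toRatAlgebra
  have hmem {x y : E} : y ∈ ((minpoly F x).rootSet E).toFinset ↔ IsConjRoot F x y := by
    rw [Set.mem_toFinset, isConjRoot_iff_mem_minpoly_rootSet (Normal.isIntegral inferInstance x)]
  obtain ⟨a, ha, b, hb, hab⟩ := UniqueSums.uniqueAdd_of_nonempty
    (A := ((minpoly F α).rootSet E).toFinset) (B := ((minpoly F β).rootSet E).toFinset)
    ⟨α, hmem.2 .refl⟩ ⟨β, hmem.2 .refl⟩
  obtain ⟨τ, rfl, rfl⟩ := H.exists_algEquiv_apply_eq (hmem.1 ha) (hmem.1 hb)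
  have hconj (x : E) : τ (σ x) ∈ ((minpoly F x).rootSet E).toFinset :=
    hmem.2 (isConjRoot_of_algEquiv x (σ.trans τ))
  refine τ.injective (hab (hconj α) (hconj β) ?_).1
  rw [← map_add, ← map_add, hσ, map_add]

/-- In characteristic zero, if `F(α)` and `F(β)` are linearly disjoint over `F`, then
`α ∈ F(α + β)`. -/
theorem IntermediateField.LinearDisjoint.mem_adjoin_add [CharZero F] [Normal F E] {α β : E}
    (H : (adjoin F ({α} : Set E)).LinearDisjoint (adjoin F ({β} : Set E))) :
    α ∈ adjoin F ({α + β} : Set E) := by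
  have : IsGalois F E := ⟨⟩
  have hα : α ∈ (⊥ : IntermediateField (adjoin F ({α + β} : Set E)) E) := by
    rw [InfiniteGalois.mem_bot_iff_fixed]
    intro σ
    exact H.apply_eq_of_apply_add_eq (σ.restrictScalars F)
      (σ.commutes (AdjoinSimple.gen F (α + β)))
  obtain ⟨x, hx⟩ := mem_bot.1 hα
  have hxα : (x : E) = α := hx
  have hmem : (x : E) ∈ adjoin F ({α + β} : Set E) := x.2
  rwa [hxα] at hmem

end

/-- if `α`, `β` are algebraic numbers in a fixed algebraic closure of `ℚ` such
that `ℚ(α)` and `ℚ(β)` are linearly disjoint over `ℚ`, then the compositum `ℚ(α)·ℚ(β)`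
equals `ℚ(α + β)`; in particular `ℚ(α, β) = ℚ(α + β)`. -/
theorem stmt4 (α β : AlgebraicClosure ℚ)
    (hdisj : (adjoin ℚ ({α} : Set (AlgebraicClosure ℚ))).LinearDisjoint
      (adjoin ℚ ({β} : Set (AlgebraicClosure ℚ)))) :
    adjoin ℚ ({α} : Set (AlgebraicClosure ℚ)) ⊔ adjoin ℚ ({β} : Set (AlgebraicClosure ℚ))
        = adjoin ℚ ({α + β} : Set (AlgebraicClosure ℚ)) ∧
      adjoin ℚ ({α, β} : Set (AlgebraicClosure ℚ))
        = adjoin ℚ ({α + β} : Set (AlgebraicClosure ℚ)) := by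
  have : Normal ℚ (AlgebraicClosure ℚ) := by
    have normal_algebraicClosure (k : Type) [Field k] : Normal k (AlgebraicClosure k) :=
      IsAlgClosure.normal k _
    convert! normal_algebraicClosure ℚ
  have hsup : adjoin ℚ ({α} : Set (AlgebraicClosure ℚ)) ⊔ adjoin ℚ ({β} : Set (AlgebraicClosure ℚ))
      = adjoin ℚ ({α + β} : Set (AlgebraicClosure ℚ)) := by
    apply le_antisymm
    · rw [sup_le_iff, adjoin_simple_le_iff, adjoin_simple_le_iff]
      exact ⟨hdisj.mem_adjoin_add, add_comm β α ▸ hdisj.symm.mem_adjoin_add⟩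
    · rw [adjoin_simple_le_iff]
      exact add_mem (le_sup_left (a := adjoin ℚ {α}) (mem_adjoin_simple_self ℚ α))
        (le_sup_right (b := adjoin ℚ {β}) (mem_adjoin_simple_self ℚ β))
  exact ⟨hsup, by rw [← hsup, ← adjoin_union, Set.singleton_union]⟩
end

section
/- Let f, g ∈ ℤ[x] be monic irreducible polynomials such that the number fields ℚ(α) = ℚ[x]/(f) and ℚ(β) = ℚ[x]/(g) are linearly disjoint over ℚ (α, β roots of f, g in a fixed algebraic closure). Let p be a prime and r, s ∈ 𝔽_p with f(r) ≡ 0 (mod p) and g(s) ≡ 0 (mod p). Then R_{f,g}(r + s) ≡ 0 (mod p), and consequently there is a surjective ring homomorphism ℤ[α+β] → 𝔽_p sending α+β to r+s, whose kernel (r+s, p) is a prime ideal of ℤ[α+β] of absolute norm p. -/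
open Polynomial

open IntermediateField

open scoped TensorProduct

section Sylvester

variable {R S : Type*} [CommRing R] [CommRing S]

theorem sylvester_map (n m : ℕ) (f g : R[X]) (φ : R →+* S) :
    (sylvester n m f g).map φ = sylvester n m (f.map φ) (g.map φ) := by
  ext i j
  simp only [_root_.sylvester, Matrix.map_apply, Matrix.of_apply, coeff_map]
  split_ifs <;> simp

theorem map_resultant (n m : ℕ) (f g : R[X]) (φ : R →+* S) :
    φ (resultant n m f g) = resultant n m (f.map φ) (g.map φ) := by
  rw [_root_.resultant, _root_.resultant, RingHom.map_det, RingHom.mapMatrix_apply, sylvester_map]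

theorem sum_shifted_coeff_mul_pow_s7 {f : R[X]} {n k N : ℕ} (hf : f.natDegree ≤ n)
    (h : n + k < N) (x : R) :
    ∑ j : Fin N, (if (j : ℕ) ≤ n + k then f.coeff (n + k - j) else 0) * x ^ (N - 1 - j) =
      f.eval x * x ^ (N - 1 - (n + k)) := by
  rw [Fin.sum_univ_eq_sum_range
    (fun j ↦ (if j ≤ n + k then f.coeff (n + k - j) else 0) * x ^ (N - 1 - j)) N]
  rw [← Finset.sum_subset (Finset.range_subset_range.2 (Nat.succ_le_of_lt h))
    (fun j _ hj ↦ by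
      rw [Finset.mem_range] at hj
      rw [if_neg (by omega), zero_mul])]
  rw [eval_eq_sum_range' (n := n + k + 1) (by omega), Finset.sum_mul,
    ← Finset.sum_range_reflect]
  refine Finset.sum_congr rfl fun j hj ↦ ?_
  rw [Finset.mem_range] at hj
  rw [if_pos (by omega), mul_assoc, ← pow_add]
  congr 2 <;> omega

theorem sylvester_mulVec_pow {n m : ℕ} {f g : R[X]} (hf : f.natDegree ≤ n)
    (hg : g.natDegree ≤ m) {x : R} (hfx : f.eval x = 0) (hgx : g.eval x = 0) :
    (sylvester n m f g).mulVec (fun j ↦ x ^ (m + n - 1 - j)) = 0 := by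
  ext i
  rw [Matrix.mulVec, dotProduct, Pi.zero_apply]
  by_cases hi : (i : ℕ) < m
  · simp only [_root_.sylvester, Matrix.of_apply, if_pos hi]
    rw [sum_shifted_coeff_mul_pow_s7 hf (by omega), hfx, zero_mul]
  · simp only [_root_.sylvester, Matrix.of_apply, if_neg hi]
    rw [sum_shifted_coeff_mul_pow_s7 hg (by omega), hgx, zero_mul]

theorem resultant_eq_zero_of_common_root [IsDomain R] {n m : ℕ} (h : 0 < m + n) {f g : R[X]}
    (hf : f.natDegree ≤ n) (hg : g.natDegree ≤ m) {x : R} (hfx : f.eval x = 0)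
    (hgx : g.eval x = 0) : resultant n m f g = 0 := by
  rw [_root_.resultant, ← Matrix.exists_mulVec_eq_zero_iff]
  refine ⟨_, fun h0 ↦ ?_, sylvester_mulVec_pow hf hg hfx hgx⟩
  simpa using congrFun h0 ⟨m + n - 1, by omega⟩

theorem aeval_Rres_add_eq_zero [IsDomain S] [Algebra R S] {f g : R[X]} (hf : 0 < f.natDegree)
    {r s : S} (hr : aeval r f = 0) (hs : aeval s g = 0) : aeval (r + s) (Rres f g) = 0 := by
  have hC : ((aeval (r + s) : R[X] →ₐ[R] S) : R[X] →+* S).comp C = algebraMap R S := by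
    ext; simp
  have key : aeval (r + s) (Rres f g) = resultant f.natDegree g.natDegree
      (f.map (algebraMap R S)) ((g.map (algebraMap R S)).comp (C (r + s) - X)) := by
    change ((aeval (r + s) : R[X] →ₐ[R] S) : R[X] →+* S) (Rres f g) = _
    rw [Rres, map_resultant, Polynomial.map_comp, Polynomial.map_map, Polynomial.map_map, hC]
    simp
  rw [key]
  refine resultant_eq_zero_of_common_root (x := r) (by omega) natDegree_map_le ?_ ?_ ?_
  · refine natDegree_comp_le.trans ?_
    calc _ ≤ g.natDegree * 1 :=
          Nat.mul_le_mul natDegree_map_le ((natDegree_sub_le _ _).trans (by simp))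
      _ = _ := mul_one _
  · rwa [eval_map_algebraMap]
  · simpa [eval_comp, eval_map_algebraMap] using hs

end Sylvester

section Combination

variable {R K : Type*} [CommRing R] [IsDomain R] [IsIntegrallyClosed R] [Field K] [Algebra R K]

theorem linearIndependent_pow_gen (F : Type*) [Field F] [Algebra R F] [IsFractionRing R F]
    [Algebra F K] [IsScalarTower R F K] {α : K} (hα : IsIntegral R α) :
    LinearIndependent F
      (fun i : Fin (minpoly R α).natDegree ↦ (AdjoinSimple.gen F α : F⟮α⟯) ^ (i : ℕ)) := by
  have h := linearIndependent_pow (K := F) (AdjoinSimple.gen F α)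
  rwa [minpoly_gen, minpoly.isIntegrallyClosed_eq_field_fractions' F hα,
    (minpoly.monic hα).natDegree_map] at h

variable [Module.IsTorsionFree R K]

theorem minpoly_eq_of_monic_irreducible {f : R[X]} (hf : f.Monic) (hfi : Irreducible f)
    {α : K} (hα : aeval α f = 0) : minpoly R α = f := by
  have hint : IsIntegral R α := ⟨f, hf, hα⟩
  exact eq_of_monic_of_associated (minpoly.monic hint) hf
    (((minpoly.prime_of_isIntegrallyClosed hint).irreducible).associated_of_dvd hfi
      (minpoly.isIntegrallyClosed_dvd hint hα))

/-- Evaluation at a root of the minimal polynomial, on the algebra generated by an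
integral element. -/
theorem exists_algHom_adjoin_singleton {S : Type*} [CommRing S] [Algebra R S] {f : R[X]}
    (hf : f.Monic) (hfi : Irreducible f) {α : K} (hα : aeval α f = 0) {r : S} (hr : aeval r f = 0) :
    ∃ φ : Algebra.adjoin R {α} →ₐ[R] S,
      φ ⟨α, Algebra.self_mem_adjoin_singleton R α⟩ = r := by
  have hint : IsIntegral R α := ⟨f, hf, hα⟩
  let P := Algebra.adjoin.powerBasis' hint
  have hP : minpoly R P.gen = f := by
    rw [← minpoly_eq_of_monic_irreducible hf hfi hα,
      ← minpoly.algebraMap_eq (B' := K) Subtype.val_injective P.gen]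
    simp [P]
  refine ⟨P.lift r (by rwa [hP]), ?_⟩
  have := P.lift_gen r (by rwa [hP])
  simpa [P] using this

theorem adjoin_powerBasis'_basis_apply {α : K} (hα : IsIntegral R α)
    (i : Fin (minpoly R α).natDegree) :
    ((Algebra.adjoin.powerBasis' hα).basis i : K) = α ^ (i : ℕ) := by
  have h := (Algebra.adjoin.powerBasis' hα).basis_eq_pow i
  rw [Algebra.adjoin.powerBasis'_gen] at h
  exact congrArg Subtype.val h

variable (F : Type*) [Field F] [Algebra R F] [IsFractionRing R F] [Algebra F K]
  [IsScalarTower R F K]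

theorem linearDisjoint_adjoin_singleton {α β : K} (hα : IsIntegral R α) (hβ : IsIntegral R β)
    (h : F⟮α⟯.LinearDisjoint F⟮β⟯) :
    (Algebra.adjoin R {α}).LinearDisjoint (Algebra.adjoin R {β}) := by
  refine Subalgebra.LinearDisjoint.of_basis_mul _ _ (Algebra.adjoin.powerBasis' hα).basis
    (Algebra.adjoin.powerBasis' hβ).basis ?_
  have h' := (h.linearIndependent_mul (linearIndependent_pow_gen F hα)
    (linearIndependent_pow_gen F hβ)).restrict_scalars' R
  have e : (fun i : Fin (minpoly R α).natDegree × Fin (minpoly R β).natDegree ↦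
      ((AdjoinSimple.gen F α ^ (i.1 : ℕ) : F⟮α⟯) : K) *
        ((AdjoinSimple.gen F β ^ (i.2 : ℕ) : F⟮β⟯) : K)) =
      fun i ↦ ((Algebra.adjoin.powerBasis' hα).basis i.1 : K) *
        ((Algebra.adjoin.powerBasis' hβ).basis i.2 : K) :=
    funext fun i ↦ (congrArg₂ (· * ·) (adjoin_powerBasis'_basis_apply hα i.1)
      (adjoin_powerBasis'_basis_apply hβ i.2)).symm
  exact e ▸ h'

theorem exists_algHom_adjoin_add {S : Type*} [CommRing S] [Algebra R S] {f g : R[X]}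
    (hf : f.Monic) (hg : g.Monic) (hfi : Irreducible f) (hgi : Irreducible g) {α β : K} (hα : aeval α f = 0)
    (hβ : aeval β g = 0) (h : F⟮α⟯.LinearDisjoint F⟮β⟯) {r s : S} (hr : aeval r f = 0)
    (hs : aeval s g = 0) :
    ∃ φ : Algebra.adjoin R {α + β} →ₐ[R] S,
      φ ⟨α + β, Algebra.self_mem_adjoin_singleton R (α + β)⟩ = r + s := by
  obtain ⟨φ, hφ⟩ := exists_algHom_adjoin_singleton hf hfi hα hr
  obtain ⟨ψ, hψ⟩ := exists_algHom_adjoin_singleton hg hgi hβ hs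
  have hd := linearDisjoint_adjoin_singleton F ⟨f, hf, hα⟩ ⟨g, hg, hβ⟩ h
  have hαA := Algebra.self_mem_adjoin_singleton R α
  have hβB := Algebra.self_mem_adjoin_singleton R β
  have hle : Algebra.adjoin R {α + β} ≤ Algebra.adjoin R {α} ⊔ Algebra.adjoin R {β} :=
    Algebra.adjoin_singleton_le
      (add_mem (Algebra.mem_sup_left hαA) (Algebra.mem_sup_right hβB))
  refine ⟨((Algebra.TensorProduct.lift φ ψ fun _ _ ↦ Commute.all _ _).comp
    (hd.mulMap.symm : _ →ₐ[R] _)).comp (Subalgebra.inclusion hle), ?_⟩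
  have e : hd.mulMap.symm (Subalgebra.inclusion hle
      ⟨α + β, Algebra.self_mem_adjoin_singleton R (α + β)⟩) =
      ⟨α, hαA⟩ ⊗ₜ 1 + 1 ⊗ₜ ⟨β, hβB⟩ := by
    rw [AlgEquiv.symm_apply_eq]
    ext
    simp
  rw [AlgHom.comp_apply, AlgHom.comp_apply]
  erw [e]
  simp [hφ, hψ]

end Combination

/-- for monic irreducible `f, g ∈ ℤ[x]` with roots `α, β` generating linearly
disjoint number fields, a prime `p`, and roots `r, s ∈ 𝔽_p` of `f mod p`, `g mod p`,
one has `R_{f,g}(r+s) ≡ 0 (mod p)`; consequently there is a surjective ring homomorphism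
`ℤ[α+β] → 𝔽_p` sending `α+β` to `r+s`, whose kernel `(r+s, p)` is a prime ideal of
`ℤ[α+β]` of absolute norm `p`. -/
theorem stmt7 (f g : ℤ[X]) (hf : f.Monic) (hg : g.Monic)
    (hfi : Irreducible f) (hgi : Irreducible g)
    (α β : AlgebraicClosure ℚ)
    (hα : Polynomial.aeval α f = 0) (hβ : Polynomial.aeval β g = 0)
    (hdisj : (adjoin ℚ ({α} : Set (AlgebraicClosure ℚ))).LinearDisjoint
      (adjoin ℚ ({β} : Set (AlgebraicClosure ℚ))))
    (p : ℕ) (hp : p.Prime) (r s : ZMod p)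
    (hr : Polynomial.aeval r f = 0) (hs : Polynomial.aeval s g = 0) :
    Polynomial.aeval (r + s) (Rres f g) = 0 ∧
    ∃ φ : (Algebra.adjoin ℤ ({α + β} : Set (AlgebraicClosure ℚ))) →+* ZMod p,
      Function.Surjective φ ∧
      φ ⟨α + β, Algebra.self_mem_adjoin_singleton ℤ (α + β)⟩ = r + s ∧
      (RingHom.ker φ).IsPrime ∧
      Nat.card ((Algebra.adjoin ℤ ({α + β} : Set (AlgebraicClosure ℚ))) ⧸ RingHom.ker φ) = p := by
  have : Fact p.Prime := ⟨hp⟩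
  have hdeg : 0 < f.natDegree := by
    refine Nat.pos_of_ne_zero fun h0 ↦ hfi.not_isUnit ?_
    rw [hf.natDegree_eq_zero.1 h0]
    exact isUnit_one
  refine ⟨aeval_Rres_add_eq_zero hdeg hr hs, ?_⟩
  obtain ⟨φ, hφ⟩ := exists_algHom_adjoin_add ℚ hf hg hfi hgi hα hβ hdisj hr hs
  have hsurj := ZMod.ringHom_surjective (φ : Algebra.adjoin ℤ {α + β} →+* ZMod p)
  refine ⟨φ, hsurj, hφ, RingHom.ker_isPrime _, ?_⟩
  rw [Nat.card_congr (RingHom.quotientKerEquivOfSurjective hsurj).toEquiv, Nat.card_zmod]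
end

section
/- Let f ∈ ℤ[x] be a monic polynomial and let L be the splitting field of f over ℚ. Let p be a prime and let h ∈ 𝔽_p[x] be an irreducible factor of the reduction of f modulo p. Then deg h divides [L : ℚ]. -/
open Polynomial

/-- The inertia degree of a prime in a finite Galois extension divides the order of the Galois
group. -/
theorem Ideal.inertiaDeg_dvd_natCard {A B : Type*} [CommRing A] [IsDomain A] [CommRing B]
    [IsDomain B] [Algebra A B] [Module.Finite A B] [Module.Flat A B] (G : Type*) [Group G]
    [Finite G] [MulSemiringAction G B] [IsGaloisGroup G A B] (p : Ideal A) [p.IsPrime]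
    (P : Ideal B) [P.IsPrime] [P.LiesOver p] : P.inertiaDeg A ∣ Nat.card G := by
  rw [← Ideal.ncard_primesOver_mul_ramificationIdxIn_mul_inertiaDegIn p B G,
    Ideal.inertiaDegIn_eq_inertiaDeg p P G]
  exact (Dvd.intro_left _ rfl).mul_left _

/-- A monic integer polynomial which splits over a number field splits over its ring of
integers. -/
theorem NumberField.splits_map_ringOfIntegers {K : Type*} [Field K] [NumberField K] {f : ℤ[X]}
    (hf : f.Monic) (hs : (f.map (algebraMap ℤ K)).Splits) :
    (f.map (algebraMap ℤ (NumberField.RingOfIntegers K))).Splits := by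
  have hmap : (f.map (algebraMap ℤ (NumberField.RingOfIntegers K))).map
      (algebraMap (NumberField.RingOfIntegers K) K) = f.map (algebraMap ℤ K) := by
    rw [Polynomial.map_map, ← IsScalarTower.algebraMap_eq]
  refine Polynomial.Splits.of_splits_map_of_injective
    (FaithfulSMul.algebraMap_injective (NumberField.RingOfIntegers K) K) (hmap ▸ hs) ?_
  intro a ha
  rw [hmap, mem_roots (hf.map _).ne_zero, IsRoot.def, eval_map] at ha
  exact ⟨⟨a, f, hf, ha⟩, rfl⟩

/-- If a polynomial over a field `F` splits in a finite extension, the degree of each of its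
irreducible factors divides the degree of the extension. -/
theorem Irreducible.natDegree_dvd_finrank_of_splits {F k : Type*} [Field F] [Field k]
    [Algebra F k] [FiniteDimensional F k] {h : F[X]} (hirr : Irreducible h)
    (hs : (h.map (algebraMap F k)).Splits) : h.natDegree ∣ Module.finrank F k := by
  obtain ⟨a, ha⟩ := hs.exists_eval_eq_zero (by
    rw [degree_map]; exact hirr.degree_pos.ne')
  rw [eval_map_algebraMap] at ha
  have hdeg : (minpoly F a).natDegree = h.natDegree := by
    rw [← minpoly.eq_of_irreducible hirr ha, natDegree_mul_C]
    exact inv_ne_zero (leadingCoeff_ne_zero.mpr hirr.ne_zero)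
  exact hdeg ▸ minpoly.degree_dvd (Algebra.IsIntegral.isIntegral a)

/-- The degree of an irreducible factor modulo `p` of a monic integer polynomial divides the degree
of any number field that is Galois over `ℚ` and over which the polynomial splits. -/
theorem NumberField.natDegree_dvd_finrank_of_splits (L : Type*) [Field L] [NumberField L]
    [IsGalois ℚ L] {f : ℤ[X]} (hf : f.Monic) (hsL : (f.map (algebraMap ℤ L)).Splits)
    (p : ℕ) [Fact p.Prime] {h : (ZMod p)[X]} (hirr : Irreducible h)
    (hdvd : h ∣ f.map (Int.castRingHom (ZMod p))) : h.natDegree ∣ Module.finrank ℚ L := by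
  have hs := splits_map_ringOfIntegers hf hsL
  set P₀ : Ideal ℤ := Ideal.span {(p : ℤ)}
  have : P₀.IsMaximal := Int.ideal_span_isMaximal_of_prime p
  obtain ⟨P, hP, hPover⟩ := Ideal.exists_maximal_ideal_liesOver_of_isIntegral
    (S := NumberField.RingOfIntegers L) P₀
  set k := NumberField.RingOfIntegers L ⧸ P
  let : Field k := Ideal.Quotient.field P
  let e := Int.quotientSpanNatEquivZMod p
  let : Algebra (ZMod p) k := ((algebraMap (ℤ ⧸ P₀) k).comp e.symm.toRingHom).toAlgebra
  have hfin : Module.finrank (ZMod p) k = P.inertiaDeg ℤ := by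
    rw [Ideal.inertiaDeg_eq_of_isMaximal P₀ P]
    refine Algebra.finrank_eq_of_equiv_equiv e.symm (RingEquiv.refl k) ?_
    ext; rfl
  have : FiniteDimensional (ZMod p) k := by
    have : Finite k := inferInstanceAs (Finite (NumberField.RingOfIntegers L ⧸ P))
    exact Module.Finite.of_finite
  have hsk : (h.map (algebraMap (ZMod p) k)).Splits := by
    have hmap : (f.map (Int.castRingHom (ZMod p))).map (algebraMap (ZMod p) k) =
        (f.map (algebraMap ℤ (NumberField.RingOfIntegers L))).map (Ideal.Quotient.mk P) := by
      rw [Polynomial.map_map, Polynomial.map_map]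
      congr 1
      exact RingHom.ext_int _ _
    refine Splits.of_dvd (hs.map (Ideal.Quotient.mk P)) ((hf.map _).map _).ne_zero ?_
    rw [← hmap]
    exact Polynomial.map_dvd _ hdvd
  have hdiv := hirr.natDegree_dvd_finrank_of_splits hsk
  rw [hfin] at hdiv
  rw [← IsGalois.card_aut_eq_finrank ℚ L]
  exact hdiv.trans (Ideal.inertiaDeg_dvd_natCard Gal(L/ℚ) P₀ P)

/-- The degree of an irreducible factor modulo `p` of a monic integer polynomial divides the degree
of any splitting field of the polynomial over `ℚ`. -/
theorem Polynomial.natDegree_dvd_finrank_of_isSplittingField (L : Type*) [Field L]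
    [algL : Algebra ℚ L] {f : ℤ[X]} (hf : f.Monic)
    [IsSplittingField ℚ L (f.map (Int.castRingHom ℚ))]
    (p : ℕ) [Fact p.Prime] {h : (ZMod p)[X]} (hirr : Irreducible h)
    (hdvd : h ∣ f.map (Int.castRingHom (ZMod p))) : h.natDegree ∣ Module.finrank ℚ L := by
  have : CharZero L := charZero_of_injective_algebraMap (algebraMap ℚ L).injective
  obtain rfl : algL = DivisionRing.toRatAlgebra := Subsingleton.elim _ _
  have : FiniteDimensional ℚ L :=
    IsSplittingField.finiteDimensional L (f.map (Int.castRingHom ℚ))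
  have : NumberField L := {}
  have : Normal ℚ L := Normal.of_isSplittingField (f.map (Int.castRingHom ℚ))
  have : IsGalois ℚ L := {}
  have hsL := IsSplittingField.splits L (f.map (Int.castRingHom ℚ))
  rw [Polynomial.map_map, RingHom.ext_int (RingHom.comp _ _) (algebraMap ℤ L)] at hsL
  exact NumberField.natDegree_dvd_finrank_of_splits L hf hsL p hirr hdvd

/-- for `f ∈ ℤ[x]` monic with splitting field `L` over `ℚ`, a prime `p`, and an
irreducible factor `h ∈ 𝔽_p[x]` of the reduction of `f` modulo `p`, the degree of `h`
divides `[L : ℚ]`. -/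
theorem stmt9 (f : ℤ[X]) (hf : f.Monic) (p : ℕ) (hp : p.Prime)
    (h : (ZMod p)[X]) (hirr : Irreducible h)
    (hdvd : h ∣ f.map (Int.castRingHom (ZMod p))) :
    h.natDegree ∣ Module.finrank ℚ (f.map (Int.castRingHom ℚ)).SplittingField := by
  have : Fact p.Prime := ⟨hp⟩
  convert @natDegree_dvd_finrank_of_isSplittingField _ _ _ f hf
    (IsSplittingField.splittingField (f.map (Int.castRingHom ℚ))) p _ h hirr hdvd
end

section
/- Let α, β be algebraic integers with ℚ(α) and ℚ(β) linearly disjoint over ℚ, with monic minimal polynomials f(x) = Σ_{i=0}^n a_i x^i and g(x) = Σ_{i=0}^m b_i x^i in ℤ[x]. Let e, d ∈ ℤ be coprime, ξ = e + d(α+β), χ_α = Σ_{i=0}^m (−d)^i (e+dα)^{m−i} b_{m−i} ∈ ℤ[α], χ_β = Σ_{i=0}^n (−d)^i (e+dβ)^{n−i} a_{n−i} ∈ ℤ[β]. Let p be a prime and r, s ∈ 𝔽_p with f(r) ≡ 0 and g(s) ≡ 0 (mod p), and suppose Σ_{i=0}^m (−d)^i (e+dr)^{m−i} b_{m−i} ≡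 0 (mod p) and Σ_{i=0}^n (−d)^i (e+ds)^{n−i} a_{n−i} ≡ 0 (mod p) (i.e. the first-degree primes (r,p) ⊆ ℤ[α] and (s,p) ⊆ ℤ[β] divide (χ_α) and (χ_β) respectively). Then p does not divide d, and, setting φ(x) = −x − d^{−1}e in 𝔽_p: φ(r) is a root of g mod p, φ(s) is a root of f mod p, and if φ(r) = s or φ(s) = r, then e + d(r+s) ≡ 0 (mod p), i.e. ξ lies in the combination ideal (r+s, p) = ker(ev_{α+β ↦ r+s} : ℤ[α+β] → 𝔽_p). -/
open Polynomial IntermediateField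

/-- A homogenized polynomial vanishing at `(u, c)` with `c ≠ 0` has the root `u / c`. -/
theorem aeval_div_eq_zero_of_homogenized_sum_eq_zero {K : Type*} [Field K] (h : ℤ[X]) (c u : K)
    (hc : c ≠ 0)
    (hsum : ∑ i ∈ Finset.range (h.natDegree + 1),
      c ^ i * u ^ (h.natDegree - i) * ((h.coeff (h.natDegree - i) : ℤ) : K) = 0) :
    Polynomial.aeval (u / c) h = 0 := by
  have key : c ^ h.natDegree * Polynomial.aeval (u / c) h = 0 := by
    rw [← hsum, Polynomial.aeval_eq_sum_range, Finset.mul_sum, ← Finset.sum_range_reflect]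
    refine Finset.sum_congr rfl fun i hi => ?_
    have hle : i ≤ h.natDegree := Nat.lt_succ_iff.mp (Finset.mem_range.mp hi)
    have hpow : c ^ h.natDegree = c ^ i * c ^ (h.natDegree - i) := by
      rw [← pow_add, Nat.add_sub_cancel' hle]
    rw [Nat.add_sub_cancel, hpow, zsmul_eq_mul, div_pow]
    field_simp
  exact (mul_eq_zero.mp key).resolve_left (pow_ne_zero _ hc)

/-- with `α`, `β` algebraic integers generating linearly disjoint number
fields, with monic minimal polynomials `f` (degree `n`) and `g` (degree `m`) over `ℤ`,
`e, d` coprime integers, `p` a prime and `r, s ∈ 𝔽_p` roots of `f mod p`, `g mod p` such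
that the first-degree primes `(r,p) ⊆ ℤ[α]` and `(s,p) ⊆ ℤ[β]` divide `(χ_α)` and `(χ_β)`
respectively (expressed by the vanishing mod `p` of the corresponding sums): `p ∤ d`, and,
with `φ(x) = −x − d⁻¹e` in `𝔽_p`, `φ(r)` is a root of `g mod p`, `φ(s)` is a root of
`f mod p`, and if `φ(r) = s` or `φ(s) = r` then `e + d(r+s) ≡ 0 (mod p)`, i.e. `ξ` lies
in the combination ideal `(r+s, p)`. -/
theorem stmt13 (α β : AlgebraicClosure ℚ)
    (hαint : IsIntegral ℤ α) (hβint : IsIntegral ℤ β)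
    (hdisj : (adjoin ℚ ({α} : Set (AlgebraicClosure ℚ))).LinearDisjoint
      (adjoin ℚ ({β} : Set (AlgebraicClosure ℚ))))
    (f g : ℤ[X]) (hfdef : f = minpoly ℤ α) (hgdef : g = minpoly ℤ β)
    (n m : ℕ) (hn : f.natDegree = n) (hm : g.natDegree = m)
    (e d : ℤ) (hed : IsCoprime e d)
    (p : ℕ) [hp : Fact p.Prime] (r s : ZMod p)
    (hr : Polynomial.aeval r f = 0) (hs : Polynomial.aeval s g = 0)
    (hχα : ∑ i ∈ Finset.range (m + 1),
      (-(d : ZMod p)) ^ i * ((e : ZMod p) + (d : ZMod p) * r) ^ (m - i) *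
        ((g.coeff (m - i) : ℤ) : ZMod p) = 0)
    (hχβ : ∑ i ∈ Finset.range (n + 1),
      (-(d : ZMod p)) ^ i * ((e : ZMod p) + (d : ZMod p) * s) ^ (n - i) *
        ((f.coeff (n - i) : ℤ) : ZMod p) = 0) :
    ¬ (p : ℤ) ∣ d ∧
    Polynomial.aeval (-r - (d : ZMod p)⁻¹ * (e : ZMod p)) g = 0 ∧
    Polynomial.aeval (-s - (d : ZMod p)⁻¹ * (e : ZMod p)) f = 0 ∧
    ((-r - (d : ZMod p)⁻¹ * (e : ZMod p) = s ∨ -s - (d : ZMod p)⁻¹ * (e : ZMod p) = r) →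
      (e : ZMod p) + (d : ZMod p) * (r + s) = 0) := by
  have hd : (d : ZMod p) ≠ 0 := by
    intro hd
    have hg : g.coeff m = 1 := by
      rw [← hm, hgdef]
      exact minpoly.monic hβint
    obtain ⟨a, b, hab⟩ := hed
    have hab' := congrArg (Int.cast : ℤ → ZMod p) hab
    push_cast at hab'
    rw [Finset.sum_range_succ', Finset.sum_eq_zero (fun i _ => by simp [hd])] at hχα
    simp only [hd, hg, zero_mul, add_zero, zero_add, Nat.sub_zero, pow_zero, one_mul,
      Int.cast_one, mul_one] at hχα
    rw [eq_zero_of_pow_eq_zero hχα, hd] at hab'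
    simp at hab'
  subst hn hm
  have hφ (x : ZMod p) :
      -x - (d : ZMod p)⁻¹ * (e : ZMod p) = ((e : ZMod p) + d * x) / (-(d : ZMod p)) := by
    field_simp
    ring
  refine ⟨fun h => hd ((ZMod.intCast_zmod_eq_zero_iff_dvd d p).mpr h), ?_, ?_, ?_⟩
  · rw [hφ]
    exact aeval_div_eq_zero_of_homogenized_sum_eq_zero g _ _ (neg_ne_zero.mpr hd) hχα
  · rw [hφ]
    exact aeval_div_eq_zero_of_homogenized_sum_eq_zero f _ _ (neg_ne_zero.mpr hd) hχβ
  · rintro (h | h)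
    all_goals
      rw [← h]
      field_simp
      ring
end

section
/- Let f(x) = Σ_{i=0}^n a_i x^i and g(x) = Σ_{i=0}^m b_i x^i be monic polynomials in ℤ[x], let e, d ∈ ℤ be coprime, and let p be a prime. Let r, s ∈ 𝔽_p satisfy f(r) ≡ 0 (mod p), g(s) ≡ 0 (mod p), and e + d(r+s) ≡ 0 (mod p). Then Σ_{i=0}^m (−d)^i (e+dr)^{m−i} b_{m−i} ≡ 0 (mod p) and Σ_{i=0}^n (−d)^i (e+ds)^{n−i} a_{n−i} ≡ 0 (mod p). (In the ideal-theoretic language: if the first-degree prime (r+s, p) of ℤ[α+β] divides the principal ideal generated by e + d(α+β), then (r,p) ⊆ ℤ[α] divides (χ_α) and (s,p) ⊆ ℤ[β] divides (χ_β).) -/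
open Polynomial

/-- If `u = c * x`, the homogenization of `q` at `(u, c)` is `c ^ natDegree q * q(x)`; in particular
it vanishes when `x` is a root of `q`. -/
theorem sum_pow_mul_pow_mul_coeff_eq_zero {A : Type*} [CommRing A] (q : ℤ[X]) {x c u : A}
    (hx : aeval x q = 0) (hu : u = c * x) :
    ∑ i ∈ Finset.range (q.natDegree + 1),
      c ^ i * u ^ (q.natDegree - i) * ((q.coeff (q.natDegree - i) : ℤ) : A) = 0 := by
  have key : ∀ i ∈ Finset.range (q.natDegree + 1),
      c ^ i * u ^ (q.natDegree - i) * ((q.coeff (q.natDegree - i) : ℤ) : A) =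
        c ^ q.natDegree * (q.coeff (q.natDegree - i) • x ^ (q.natDegree - i)) := by
    intro i hi
    have hc : c ^ q.natDegree = c ^ i * c ^ (q.natDegree - i) := by
      rw [← pow_add, Nat.add_sub_cancel' (Finset.mem_range_succ_iff.mp hi)]
    rw [hu, mul_pow, zsmul_eq_mul, hc]
    ring
  rw [Finset.sum_congr rfl key, ← Finset.mul_sum,
    Finset.sum_flip (fun k => q.coeff k • x ^ k), ← aeval_eq_sum_range, hx, mul_zero]

/-- let `f = Σ aᵢ xⁱ` and `g = Σ bᵢ xⁱ` be monic polynomials in `ℤ[x]` of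
degrees `n` and `m`, `e, d` coprime integers and `p` a prime.  If `r, s ∈ 𝔽_p` satisfy
`f(r) ≡ 0`, `g(s) ≡ 0` and `e + d(r+s) ≡ 0 (mod p)`, then
`Σ_{i=0}^m (−d)^i (e+dr)^{m−i} b_{m−i} ≡ 0 (mod p)` and
`Σ_{i=0}^n (−d)^i (e+ds)^{n−i} a_{n−i} ≡ 0 (mod p)`. -/
theorem stmt14 (f g : ℤ[X]) (hf : f.Monic) (hg : g.Monic)
    (n m : ℕ) (hn : f.natDegree = n) (hm : g.natDegree = m)
    (e d : ℤ) (hed : IsCoprime e d)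
    (p : ℕ) (hp : p.Prime) (r s : ZMod p)
    (hr : Polynomial.aeval r f = 0) (hs : Polynomial.aeval s g = 0)
    (h : (e : ZMod p) + (d : ZMod p) * (r + s) = 0) :
    ∑ i ∈ Finset.range (m + 1),
        (-(d : ZMod p)) ^ i * ((e : ZMod p) + (d : ZMod p) * r) ^ (m - i) *
          ((g.coeff (m - i) : ℤ) : ZMod p) = 0 ∧
    ∑ i ∈ Finset.range (n + 1),
        (-(d : ZMod p)) ^ i * ((e : ZMod p) + (d : ZMod p) * s) ^ (n - i) *
          ((f.coeff (n - i) : ℤ) : ZMod p) = 0 := by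
  subst hn hm
  exact ⟨sum_pow_mul_pow_mul_coeff_eq_zero g hs (by linear_combination h),
    sum_pow_mul_pow_mul_coeff_eq_zero f hr (by linear_combination h)⟩
end

section
/- Let α, β be algebraic integers with ℚ(α) and ℚ(β) linearly disjoint over ℚ, with monic minimal polynomials f(x) = Σ_{i=0}^n a_i x^i and g(x) = Σ_{i=0}^m b_i x^i in ℤ[x]. Let e, d ∈ ℤ, and set ξ = e + d(α+β), χ_α = Σ_{i=0}^m (−d)^i (e+dα)^{m−i} b_{m−i}, χ_β = Σ_{i=0}^n (−d)^i (e+dβ)^{n−i} a_{n−i}. Then N_{ℚ(α+β)/ℚ}(ξ) = N_{ℚ(α)/ℚ}(χ_α) = N_{ℚ(β)/ℚ}(χ_β). -/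
open Polynomial IntermediateField

namespace Polynomial

theorem scaleRoots_multiset_prod {R : Type*} [CommRing R] [IsDomain R] (s : Multiset R[X]) (r : R) :
    s.prod.scaleRoots r = (s.map (·.scaleRoots r)).prod := by
  induction s using Multiset.induction_on with
  | empty => simp
  | cons p s ih => simp [mul_scaleRoots_of_noZeroDivisors, ih]

theorem eval_scaleRoots_eq_sum_range {R : Type*} [CommRing R] (p : R[X]) (r x : R) :
    (p.scaleRoots r).eval x = ∑ i ∈ Finset.range (p.natDegree + 1),
      r ^ i * x ^ (p.natDegree - i) * p.coeff (p.natDegree - i) := by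
  rw [eval_eq_sum_range, natDegree_scaleRoots, ← Finset.sum_range_reflect]
  refine Finset.sum_congr rfl fun i hi ↦ ?_
  have hi : i ≤ p.natDegree := Nat.lt_succ_iff.mp (Finset.mem_range.mp hi)
  rw [coeff_scaleRoots, Nat.add_sub_cancel, Nat.sub_sub_self hi]
  ring

end Polynomial

section Embeddings

variable {F L : Type*} [Field F] [CharZero F] [Field L] [Algebra F L] [IsAlgClosed L]

theorem minpoly_map_eq_prod_embeddings {β : L} (hβ : IsIntegral F β) [Fintype (F⟮β⟯ →ₐ[F] L)] :
    (minpoly F β).map (algebraMap F L) =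
      ∏ τ : F⟮β⟯ →ₐ[F] L, (X - C (τ (AdjoinSimple.gen F β))) := by
  classical
  have hsplit := IsAlgClosed.splits ((minpoly F β).map (algebraMap F L))
  rw [hsplit.eq_prod_roots_of_monic ((minpoly.monic hβ).map _)]
  have hnodup : ((minpoly F β).aroots L).Nodup :=
    nodup_roots (.map (minpoly.irreducible hβ).separable)
  symm
  calc
    _ = ∏ x : {x // x ∈ (minpoly F β).aroots L}, (X - C (x : L)) := by
      refine Fintype.prod_equiv (algHomAdjoinIntegralEquiv F hβ) _ _ fun τ ↦ ?_
      conv_lhs => rw [← (algHomAdjoinIntegralEquiv F (K := L) hβ).symm_apply_apply τ]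
      rw [algHomAdjoinIntegralEquiv_symm_apply_gen]
    _ = _ := by
      rw [Finset.prod_mem_multiset ((minpoly F β).aroots L) _ (fun x : L ↦ X - C x) fun _ ↦ rfl,
        Finset.prod_eq_multiset_prod, Multiset.toFinset_val, hnodup.dedup, aroots_def]

theorem prod_embeddings_sub_mul_eq_sum {β : L} (hβ : IsIntegral F β)
    [Fintype (F⟮β⟯ →ₐ[F] L)] (r x : L) :
    ∏ τ : F⟮β⟯ →ₐ[F] L, (x - r * τ (AdjoinSimple.gen F β)) =
      ∑ i ∈ Finset.range ((minpoly F β).natDegree + 1),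
        r ^ i * x ^ ((minpoly F β).natDegree - i) *
          algebraMap F L ((minpoly F β).coeff ((minpoly F β).natDegree - i)) := by
  have h := eval_scaleRoots_eq_sum_range ((minpoly F β).map (algebraMap F L)) r x
  simp only [natDegree_map, coeff_map] at h
  rw [← h, minpoly_map_eq_prod_embeddings hβ]
  simp only [Finset.prod_eq_multiset_prod]
  rw [scaleRoots_multiset_prod, eval_multiset_prod]
  simp [Multiset.map_map, X_sub_C_scaleRoots, mul_comm]

namespace IntermediateField.LinearDisjoint

theorem bijective_restrict_embeddings {A B : IntermediateField F L} [FiniteDimensional F A]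
    [FiniteDimensional F B] (h : A.LinearDisjoint B) :
    Function.Bijective fun ψ : ↥(A ⊔ B) →ₐ[F] L ↦
      (ψ.comp (inclusion (le_sup_left : A ≤ A ⊔ B)),
        ψ.comp (inclusion (le_sup_right : B ≤ A ⊔ B))) := by
  classical
  rw [Fintype.bijective_iff_injective_and_card]
  constructor
  · intro φ ψ hφψ
    obtain ⟨h₁, h₂⟩ := Prod.mk.inj hφψ
    refine algHom_ext_of_eq_adjoin F (S := A ⊔ B) (s := (A : Set L) ∪ B) rfl ?_
    rintro x (hx | hx)
    · exact DFunLike.congr_fun h₁ ⟨x, hx⟩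
    · exact DFunLike.congr_fun h₂ ⟨x, hx⟩
  · simp only [Fintype.card_prod, AlgHom.card, h.finrank_sup]

theorem adjoin_simple_add_eq_sup {α β : L} (hα : IsIntegral F α) (hβ : IsIntegral F β)
    (h : F⟮α⟯.LinearDisjoint F⟮β⟯) : F⟮α + β⟯ = F⟮α⟯ ⊔ F⟮β⟯ := by
  classical
  have : CharZero L := charZero_of_injective_algebraMap (algebraMap F L).injective
  have : FiniteDimensional F F⟮α⟯ := adjoin.finiteDimensional hα
  have : FiniteDimensional F F⟮β⟯ := adjoin.finiteDimensional hβ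
  let S : Finset L := Finset.univ.image fun σ : F⟮α⟯ →ₐ[F] L ↦ σ (AdjoinSimple.gen F α)
  let T : Finset L := Finset.univ.image fun τ : F⟮β⟯ →ₐ[F] L ↦ τ (AdjoinSimple.gen F β)
  have hS : S.Nonempty := ⟨_, Finset.mem_image_of_mem _ (Finset.mem_univ (val _))⟩
  have hT : T.Nonempty := ⟨_, Finset.mem_image_of_mem _ (Finset.mem_univ (val _))⟩
  obtain ⟨a, ha, b, hb, hab⟩ := UniqueSums.uniqueAdd_of_nonempty hS hT
  obtain ⟨σ, -, rfl⟩ := Finset.mem_image.mp ha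
  obtain ⟨τ, -, rfl⟩ := Finset.mem_image.mp hb
  obtain ⟨φ, hφ⟩ := h.bijective_restrict_embeddings.surjective (σ, τ)
  obtain ⟨rfl, rfl⟩ := Prod.mk.inj hφ
  let a' := inclusion (le_sup_left : F⟮α⟯ ≤ F⟮α⟯ ⊔ F⟮β⟯) (AdjoinSimple.gen F α)
  let b' := inclusion (le_sup_right : F⟮β⟯ ≤ F⟮α⟯ ⊔ F⟮β⟯) (AdjoinSimple.gen F β)
  have htop : F⟮a' + b'⟯ = ⊤ := by
    refine (Field.primitive_element_iff_algHom_eq_of_eval F L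
      (fun _ ↦ IsAlgClosed.splits _) _ φ).mpr fun ψ hψ ↦ ?_
    have key := hab (a := ψ a') (b := ψ b')
      (Finset.mem_image.mpr ⟨ψ.comp (inclusion le_sup_left), Finset.mem_univ _, rfl⟩)
      (Finset.mem_image.mpr ⟨ψ.comp (inclusion le_sup_right), Finset.mem_univ _, rfl⟩)
      (by rw [← map_add, ← hψ, map_add]; rfl)
    refine h.bijective_restrict_embeddings.injective (Prod.ext ?_ ?_)
    · refine adjoin_algHom_ext F fun x hx ↦ ?_
      obtain rfl := Set.mem_singleton_iff.mp hx
      exact key.1.symm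
    · refine adjoin_algHom_ext F fun x hx ↦ ?_
      obtain rfl := Set.mem_singleton_iff.mp hx
      exact key.2.symm
  have := congrArg lift htop
  rwa [lift_adjoin_simple, lift_top] at this

theorem norm_add_mul_add_gen {α β : L} (hα : IsIntegral F α) (hβ : IsIntegral F β)
    (h : F⟮α⟯.LinearDisjoint F⟮β⟯) [FiniteDimensional F F⟮α⟯] [FiniteDimensional F F⟮β⟯] (e d : F) :
    algebraMap F L (Algebra.norm F
      (algebraMap F F⟮α + β⟯ e + algebraMap F F⟮α + β⟯ d * AdjoinSimple.gen F (α + β))) =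
      ∏ σ : F⟮α⟯ →ₐ[F] L, ∏ τ : F⟮β⟯ →ₐ[F] L, (algebraMap F L e +
        algebraMap F L d * (σ (AdjoinSimple.gen F α) + τ (AdjoinSimple.gen F β))) := by
  classical
  let ε := equivOfEq (h.adjoin_simple_add_eq_sup hα hβ)
  have hgen : ε (AdjoinSimple.gen F (α + β)) =
      inclusion (le_sup_left : F⟮α⟯ ≤ F⟮α⟯ ⊔ F⟮β⟯) (AdjoinSimple.gen F α) +
        inclusion (le_sup_right : F⟮β⟯ ≤ F⟮α⟯ ⊔ F⟮β⟯) (AdjoinSimple.gen F β) := rfl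
  rw [← Algebra.norm_eq_of_algEquiv ε, Algebra.norm_eq_prod_embeddings]
  rw [← Fintype.prod_prod_type' fun (σ : F⟮α⟯ →ₐ[F] L) (τ : F⟮β⟯ →ₐ[F] L) ↦ algebraMap F L e +
    algebraMap F L d * (σ (AdjoinSimple.gen F α) + τ (AdjoinSimple.gen F β))]
  refine Fintype.prod_equiv (.ofBijective _ h.bijective_restrict_embeddings) _ _ fun ψ ↦ ?_
  simp [hgen]

end IntermediateField.LinearDisjoint

theorem norm_sum_coeff_minpoly_eq_prod_embeddings {α β : L} (hβ : IsIntegral F β) [FiniteDimensional F F⟮α⟯] [FiniteDimensional F F⟮β⟯] (e d : F) :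
    algebraMap F L (Algebra.norm F (∑ i ∈ Finset.range ((minpoly F β).natDegree + 1),
      (-algebraMap F F⟮α⟯ d) ^ i *
        (algebraMap F F⟮α⟯ e + algebraMap F F⟮α⟯ d * AdjoinSimple.gen F α) ^
          ((minpoly F β).natDegree - i) *
        algebraMap F F⟮α⟯ ((minpoly F β).coeff ((minpoly F β).natDegree - i)))) =
      ∏ σ : F⟮α⟯ →ₐ[F] L, ∏ τ : F⟮β⟯ →ₐ[F] L, (algebraMap F L e +
        algebraMap F L d * (σ (AdjoinSimple.gen F α) + τ (AdjoinSimple.gen F β))) := by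
  rw [Algebra.norm_eq_prod_embeddings]
  refine Fintype.prod_congr _ _ fun σ ↦ ?_
  simp only [map_sum, map_mul, map_pow, map_add, map_neg, AlgHom.commutes]
  rw [← prod_embeddings_sub_mul_eq_sum hβ]
  exact Fintype.prod_congr _ _ fun τ ↦ by ring

end Embeddings

/-- with `α`, `β` algebraic integers generating linearly disjoint number
fields, with monic minimal polynomials `f = Σ aᵢ xⁱ` (degree `n`) and `g = Σ bᵢ xⁱ`
(degree `m`) over `ℤ`, and `e, d ∈ ℤ`, the norms over `ℚ` of `ξ = e + d(α+β) ∈ ℚ(α+β)`,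
of `χ_α = Σ_{i=0}^m (−d)^i (e+dα)^{m−i} b_{m−i} ∈ ℚ(α)` and of
`χ_β = Σ_{i=0}^n (−d)^i (e+dβ)^{n−i} a_{n−i} ∈ ℚ(β)` all coincide. -/
theorem stmt15 (α β : AlgebraicClosure ℚ)
    (hαint : IsIntegral ℤ α) (hβint : IsIntegral ℤ β)
    (hdisj : (adjoin ℚ ({α} : Set (AlgebraicClosure ℚ))).LinearDisjoint
      (adjoin ℚ ({β} : Set (AlgebraicClosure ℚ))))
    (f g : ℤ[X]) (hfdef : f = minpoly ℤ α) (hgdef : g = minpoly ℤ β)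
    (n m : ℕ) (hn : f.natDegree = n) (hm : g.natDegree = m) (e d : ℤ) :
    Algebra.norm ℚ ((e : adjoin ℚ ({α + β} : Set (AlgebraicClosure ℚ)))
        + (d : adjoin ℚ ({α + β} : Set (AlgebraicClosure ℚ)))
          * ⟨α + β, mem_adjoin_simple_self ℚ (α + β)⟩)
      = Algebra.norm ℚ (∑ i ∈ Finset.range (m + 1),
          (-(d : adjoin ℚ ({α} : Set (AlgebraicClosure ℚ)))) ^ i *
            ((e : adjoin ℚ ({α} : Set (AlgebraicClosure ℚ)))
              + (d : adjoin ℚ ({α} : Set (AlgebraicClosure ℚ)))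
                * ⟨α, mem_adjoin_simple_self ℚ α⟩) ^ (m - i) *
            ((g.coeff (m - i) : ℤ) : adjoin ℚ ({α} : Set (AlgebraicClosure ℚ)))) ∧
    Algebra.norm ℚ (∑ i ∈ Finset.range (m + 1),
          (-(d : adjoin ℚ ({α} : Set (AlgebraicClosure ℚ)))) ^ i *
            ((e : adjoin ℚ ({α} : Set (AlgebraicClosure ℚ)))
              + (d : adjoin ℚ ({α} : Set (AlgebraicClosure ℚ)))
                * ⟨α, mem_adjoin_simple_self ℚ α⟩) ^ (m - i) *
            ((g.coeff (m - i) : ℤ) : adjoin ℚ ({α} : Set (AlgebraicClosure ℚ))))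
      = Algebra.norm ℚ (∑ i ∈ Finset.range (n + 1),
          (-(d : adjoin ℚ ({β} : Set (AlgebraicClosure ℚ)))) ^ i *
            ((e : adjoin ℚ ({β} : Set (AlgebraicClosure ℚ)))
              + (d : adjoin ℚ ({β} : Set (AlgebraicClosure ℚ)))
                * ⟨β, mem_adjoin_simple_self ℚ β⟩) ^ (n - i) *
            ((f.coeff (n - i) : ℤ) : adjoin ℚ ({β} : Set (AlgebraicClosure ℚ)))) := by
  classical
  subst hfdef hgdef hn hm
  have hα : IsIntegral ℚ α := hαint.tower_top
  have hβ : IsIntegral ℚ β := hβint.tower_top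
  have : FiniteDimensional ℚ ℚ⟮α⟯ := adjoin.finiteDimensional hα
  have : FiniteDimensional ℚ ℚ⟮β⟯ := adjoin.finiteDimensional hβ
  have hξ := hdisj.norm_add_mul_add_gen hα hβ e d
  have hχα := norm_sum_coeff_minpoly_eq_prod_embeddings (α := α) hβ (e : ℚ) d
  have hχβ := norm_sum_coeff_minpoly_eq_prod_embeddings (α := β) hα (e : ℚ) d
  rw [Finset.prod_comm] at hχβ
  replace hχβ := hχβ.trans (Fintype.prod_congr _ _ fun σ ↦ Fintype.prod_congr _ _ fun τ ↦
    by rw [add_comm (τ _) (σ _)])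
  simp only [minpoly.isIntegrallyClosed_eq_field_fractions' ℚ hαint,
    minpoly.isIntegrallyClosed_eq_field_fractions' ℚ hβint,
    (minpoly.monic hαint).natDegree_map, (minpoly.monic hβint).natDegree_map, coeff_map,
    eq_intCast, map_intCast] at hξ hχα hχβ
  have hinj := (algebraMap ℚ (AlgebraicClosure ℚ)).injective
  exact ⟨hinj (hξ.trans hχα.symm), hinj (hχα.trans hχβ.symm)⟩
end
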